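/- (Existence, Theorem 2.2.) Let α ∈ (1,2], β ∈ (0,1), ξ ∈ (0,1). Assume f : [0,1] × ℝ × ℝ → ℝ is continuous and: (A₁) there exist a continuous p : [0,1] → [0,∞) and a continuous nondecreasing ψ : [0,∞) → (0,∞) such that |f(t,u,z)| ≤ p(t)·ψ(|z|) for all t ∈ [0,1] and u, z ∈ ℝ; (A₂) there exists r > 0 such that r ≥ max{ G*·p*·ψ(r), p*·ψ(r)·(Γ(3−α)Γ(α−β+1) + Γ(2−β))/(Γ(3−α)Γ(α−β+1)) }, where p* = sup_{s ∈ [0,1]} p(s). Then there exist continuous functions u, v : [0,1] → ℝ with sup_{t∈[0,1]}|u(t)| ≤ r and sup_{t∈[0,1]}|v(t)| ≤ r such that for all t ∈ [0,1]: u(t) = ∫₀¹ G(t,s) f(s, u(s), v(s)) ds and v(t) = ∫₀ᵗ f(s, u(s), v(s)) ds − (Γ(2−β) t^{2−α}/(Γ(3−α)Γ(α−β))) ∫₀¹ (1−s)^{α−β−1} f(s, u(s), v(s)) ds. (The pair (u, v), with v the Caputo derivative of order α−1 of u, is a solution of the boundary value problem ᶜDᵅu(t) = f(t, u(t), ᶜD^{α−1}u(t)),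 u(0) = ξu(1), ᶜDᵝu(0) = ξ·ᶜDᵝu(1).) -/

import Mathlib

open Real MeasureTheory Set

/-- The Green function of the fractional boundary value problem. -/
noncomputable def G (α β ξ : ℝ) (t s : ℝ) : ℝ :=
  if s ≤ t then
    ((1 - ξ) * (t - s) ^ (α - 1) + ξ * (1 - s) ^ (α - 1)) / (Real.Gamma α * (1 - ξ))
      - Real.Gamma (2 - β) * (ξ + (1 - ξ) * t) * (1 - s) ^ (α - β - 1)
          / (Real.Gamma (α - β) * (1 - ξ))
  else
    ξ * (1 - s) ^ (α - 1) / (Real.Gamma α * (1 - ξ))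
      - Real.Gamma (2 - β) * (ξ + (1 - ξ) * t) * (1 - s) ^ (α - β - 1)
          / (Real.Gamma (α - β) * (1 - ξ))

/-- `G* = sup_{t ∈ [0,1]} ∫₀¹ |G(t,s)| ds`. -/
noncomputable def Gstar (α β ξ : ℝ) : ℝ :=
  ⨆ t : Set.Icc (0 : ℝ) 1, ∫ s in (0 : ℝ)..1, |G α β ξ (t : ℝ) s|

open Topology Filter

/-- A bounded continuous self-map of the plane has a fixed point. -/
theorem exists_fixedPoint_of_continuous_of_norm_le {g : ℂ → ℂ} (hg : Continuous g) {R : ℝ}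
    (hR : ∀ z, ‖g z‖ ≤ R) : ∃ z, g z = z := by
  by_contra! hne
  obtain ⟨L, hLc, hL⟩ := Complex.exists_continuousOn_eqOn_exp_comp (U := (univ : Set ℂ))
    (g := fun z => z - g z)
    ((Homeomorph.Set.univ ℂ).toHomotopyEquiv.simplyConnectedSpace_iff.2
      inferInstance)
    isOpen_univ (by fun_prop) (by
      rintro ⟨z, -, hz⟩
      exact hne z (sub_eq_zero.1 hz).symm)
  have hLc : Continuous L := continuousOn_univ.1 hLc
  have hR0 : 0 ≤ R := (norm_nonneg _).trans (hR 0)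
  have hρ : ((R + 1 : ℝ) : ℂ) ≠ 0 := by exact_mod_cast (by positivity : R + 1 ≠ 0)
  set z : ℝ → ℂ := fun θ => ((R + 1 : ℝ) : ℂ) * Complex.exp (θ * Complex.I) with hz
  have hzc : Continuous z := by fun_prop
  have hz0 : ∀ θ, z θ ≠ 0 := fun θ => mul_ne_zero hρ (Complex.exp_ne_zero _)
  have hznorm : ∀ θ, ‖z θ‖ = R + 1 := fun θ => by
    rw [hz]
    simp only [norm_mul, Complex.norm_exp_ofReal_mul_I, Complex.norm_real, mul_one]
    exact abs_of_pos (by positivity)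
  have hslit : ∀ θ, 1 - g (z θ) / z θ ∈ Complex.slitPlane := fun θ => by
    refine Complex.mem_slitPlane_of_norm_lt_one (z := - (g (z θ) / z θ)) ?_
    rw [norm_neg, norm_div, hznorm, div_lt_one (by positivity)]
    exact (hR _).trans_lt (lt_add_one R)
  set M : ℝ → ℂ := fun θ => L (z θ) - Complex.log (1 - g (z θ) / z θ) - θ * Complex.I with hM
  have hMc : Continuous M := by
    refine ((hLc.comp hzc).sub (Continuous.clog ?_ hslit)).sub (by fun_prop)
    exact continuous_const.sub ((hg.comp hzc).div hzc hz0)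
  have hexp : ∀ θ, Complex.exp (M θ) = ((R + 1 : ℝ) : ℂ) := fun θ => by
    have h1 : Complex.exp (L (z θ)) = z θ - g (z θ) := hL (mem_univ (z θ))
    have h2 := Complex.slitPlane_ne_zero (hslit θ)
    rw [hM]
    simp only
    rw [Complex.exp_sub, Complex.exp_sub, h1, Complex.exp_log h2]
    have h3 : z θ - g (z θ) = z θ * (1 - g (z θ) / z θ) := by
      field_simp [hz0 θ]
    rw [h3, mul_div_cancel_right₀ _ h2, hz]
    simp only
    rw [mul_div_cancel_right₀ _ (Complex.exp_ne_zero _)]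
  have hconst : M = fun _ => M 0 :=
    Complex.isCoveringMap_exp.eq_of_comp_eq hMc continuous_const
      (funext fun θ => Subtype.ext (by simp [hexp])) 0 rfl
  have h2π := congrFun hconst (2 * π)
  have hzz : z (2 * π) = z 0 := by simp [hz]
  simp only [hM, hzz] at h2π
  simp [Real.pi_ne_zero] at h2π

section Volterra

variable {E : Type*} [NormedAddCommGroup E] [NormedSpace ℝ E]

/-- Picard iterates of the Volterra equation with delay `δ` and parameter `c`. -/
noncomputable def delayedIterate (g : ℝ → E → ℝ) (k : ℝ → E) (L : ℝ → ℂ → E) (δ : ℝ) :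
    ℕ → ℂ → ℝ → E
  | 0 => fun _ _ => 0
  | n + 1 => fun c t =>
      L t c + ∫ s in (0 : ℝ)..t, g s (delayedIterate g k L δ n c (max (s - δ) 0)) • k (t - s)

variable {g : ℝ → E → ℝ} {k : ℝ → E} {L : ℝ → ℂ → E}

theorem continuous_delayedIterate (hg : Continuous (Function.uncurry g)) (hk : Continuous k)
    (hL : Continuous (Function.uncurry L)) (δ : ℝ) (n : ℕ) :
    Continuous (Function.uncurry (delayedIterate g k L δ n)) := by
  induction n with
  | zero => exact continuous_const
  | succ n ih =>
    refine (hL.comp (continuous_snd.prodMk continuous_fst)).add ?_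
    refine intervalIntegral.continuous_parametric_intervalIntegral_of_continuous
      (f := fun (q : ℂ × ℝ) s =>
        g s (delayedIterate g k L δ n q.1 (max (s - δ) 0)) • k (q.2 - s)) ?_ continuous_snd
    refine Continuous.smul ?_ (by fun_prop)
    have h1 : Continuous fun x : (ℂ × ℝ) × ℝ => (x.1.1, max (x.2 - δ) 0) := by fun_prop
    exact hg.comp (continuous_snd.prodMk (ih.comp h1))

theorem delayedIterate_succ_eq {δ : ℝ} (hδ : 0 < δ) (c : ℂ) (n : ℕ) {t : ℝ} (ht0 : 0 ≤ t)
    (ht : t ≤ n * δ) :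
    delayedIterate g k L δ (n + 1) c t = delayedIterate g k L δ (n + 2) c t := by
  induction n generalizing t with
  | zero =>
    obtain rfl : t = 0 := le_antisymm (by simpa using ht) ht0
    simp [delayedIterate]
  | succ n ih =>
    change L t c + (∫ s in (0 : ℝ)..t,
        g s (delayedIterate g k L δ (n + 1) c (max (s - δ) 0)) • k (t - s)) =
      L t c + ∫ s in (0 : ℝ)..t,
        g s (delayedIterate g k L δ (n + 2) c (max (s - δ) 0)) • k (t - s)
    congr 1
    refine intervalIntegral.integral_congr fun s hs => ?_
    rw [uIcc_of_le ht0] at hs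
    push_cast at ht
    rw [ih (le_max_right _ _) (max_le (by linarith [hs.2]) (by positivity))]

/-- The Volterra equation with a delay has a solution on `[0, 1]` which depends continuously on
the parameter. -/
theorem exists_delayed_solution (hg : Continuous (Function.uncurry g)) (hk : Continuous k)
    (hL : Continuous (Function.uncurry L)) {δ : ℝ} (hδ : 0 < δ) :
    ∃ W : ℂ → ℝ → E, Continuous (Function.uncurry W) ∧ ∀ c, ∀ t ∈ Icc (0 : ℝ) 1,
      W c t = L t c + ∫ s in (0 : ℝ)..t, g s (W c (max (s - δ) 0)) • k (t - s) := by
  obtain ⟨N, hN⟩ := exists_nat_ge (1 / δ)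
  refine ⟨delayedIterate g k L δ (N + 1), continuous_delayedIterate hg hk hL δ _,
    fun c t ht => ?_⟩
  rw [delayedIterate_succ_eq hδ c N ht.1 (ht.2.trans ((div_le_iff₀ hδ).1 hN))]
  rfl

theorem norm_integral_smul_le {F : ℝ → ℝ} {M : ℝ} (hF : ∀ s, |F s| ≤ M) {V : Type*}
    [NormedAddCommGroup V] [NormedSpace ℝ V] {h : ℝ → V}
    {a b : ℝ} (hab : a ≤ b) (hh : IntervalIntegrable h volume a b) :
    ‖∫ s in a..b, F s • h s‖ ≤ M * ∫ s in a..b, ‖h s‖ := by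
  rw [← intervalIntegral.integral_const_mul]
  refine intervalIntegral.norm_integral_le_of_norm_le hab (ae_of_all _ fun s _ => ?_)
    (hh.norm.const_mul M)
  rw [norm_smul]
  exact mul_le_mul_of_nonneg_right (hF s) (norm_nonneg _)

/-- The delayed system has a solution satisfying the nonlocal condition on the parameter. -/
theorem exists_delayed_solution_nonlocal (hg : Continuous (Function.uncurry g)) {M : ℝ}
    (hM : ∀ s x, |g s x| ≤ M) (hk : Continuous k) (hL : Continuous (Function.uncurry L))
    {h : ℝ → ℂ} (hh : IntervalIntegrable h volume 0 1) {δ : ℝ} (hδ : 0 < δ) :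
    ∃ (c : ℂ) (w : ℝ → E), Continuous w ∧
      (∀ t ∈ Icc (0 : ℝ) 1,
        w t = L t c + ∫ s in (0 : ℝ)..t, g s (w (max (s - δ) 0)) • k (t - s)) ∧
      c = ∫ s in (0 : ℝ)..1, g s (w (max (s - δ) 0)) • h s := by
  obtain ⟨W, hWc, hW⟩ := exists_delayed_solution hg hk hL hδ
  have hFc : Continuous fun q : ℂ × ℝ => g q.2 (W q.1 (max (q.2 - δ) 0)) := by
    have h1 : Continuous fun x : ℂ × ℝ => (x.1, max (x.2 - δ) 0) := by fun_prop
    exact hg.comp (continuous_snd.prodMk (hWc.comp h1))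
  obtain ⟨c, hc⟩ := exists_fixedPoint_of_continuous_of_norm_le
    (g := fun c => ∫ s in (0 : ℝ)..1, g s (W c (max (s - δ) 0)) • h s)
    (R := M * ∫ s in (0 : ℝ)..1, ‖h s‖) (by
      refine intervalIntegral.continuous_of_dominated_interval (bound := fun s => M * ‖h s‖)
        (fun c => ?_) (fun c => ae_of_all _ fun s _ => ?_) (hh.norm.const_mul M)
        (ae_of_all _ fun s _ => ?_)
      · exact (hFc.comp (Continuous.prodMk_right c)).aestronglyMeasurable.smul
          hh.def'.aestronglyMeasurable
      · rw [norm_smul]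
        exact mul_le_mul_of_nonneg_right (hM _ _) (norm_nonneg _)
      · exact (hFc.comp (Continuous.prodMk_left s)).smul continuous_const)
    fun c => norm_integral_smul_le (fun s => hM _ _) zero_le_one hh
  exact ⟨c, W c, hWc.comp (Continuous.prodMk_right c), hW c, hc.symm⟩


theorem continuous_convolution {F : ℝ → ℝ} (hF : Continuous F) (hk : Continuous k) :
    Continuous fun t => ∫ s in (0 : ℝ)..t, F s • k (t - s) :=
  intervalIntegral.continuous_parametric_intervalIntegral_of_continuous
    (f := fun t s => F s • k (t - s)) (by fun_prop) continuous_id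

/-- Convolutions of a fixed kernel with uniformly bounded functions share a modulus of
continuity. -/
theorem exists_modulus_convolution (hk : Continuous k) (M t₀ : ℝ) :
    ∃ ω : ℝ → ℝ, Continuous ω ∧ ω t₀ = 0 ∧ ∀ F : ℝ → ℝ, Continuous F → (∀ s, |F s| ≤ M) → ∀ t,
      ‖(∫ s in (0 : ℝ)..t, F s • k (t - s)) - ∫ s in (0 : ℝ)..t₀, F s • k (t₀ - s)‖ ≤ ω t := by
  refine ⟨fun t => |∫ s in (0 : ℝ)..t₀, M * ‖k (t - s) - k (t₀ - s)‖| +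
    |∫ s in t₀..t, M * ‖k (t - s)‖|, ?_, by simp, fun F hF hFM t => ?_⟩
  · refine Continuous.add ?_ ?_
    · exact (intervalIntegral.continuous_parametric_intervalIntegral_of_continuous'
        (f := fun t s => M * ‖k (t - s) - k (t₀ - s)‖) (by fun_prop) _ _).abs
    · exact (intervalIntegral.continuous_parametric_intervalIntegral_of_continuous
        (f := fun t s => M * ‖k (t - s)‖) (by fun_prop) continuous_id).abs
  · have hi : ∀ a b : ℝ, ∀ r : ℝ, IntervalIntegrable (fun s => F s • k (r - s)) volume a b :=
      fun a b r => Continuous.intervalIntegrable (by fun_prop) _ _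
    have hsplit : (∫ s in (0 : ℝ)..t, F s • k (t - s)) - ∫ s in (0 : ℝ)..t₀, F s • k (t₀ - s) =
        (∫ s in (0 : ℝ)..t₀, F s • (k (t - s) - k (t₀ - s))) +
          ∫ s in t₀..t, F s • k (t - s) := by
      rw [← intervalIntegral.integral_add_adjacent_intervals (hi 0 t₀ t) (hi t₀ t t)]
      simp only [smul_sub]
      rw [intervalIntegral.integral_sub (hi _ _ _) (hi _ _ _)]
      abel
    rw [hsplit]
    refine (norm_add_le _ _).trans (add_le_add ?_ ?_)
    · refine intervalIntegral.norm_integral_le_abs_of_norm_le (ae_of_all _ fun s => ?_)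
        (Continuous.intervalIntegrable (by fun_prop) _ _)
      rw [norm_smul]
      exact mul_le_mul_of_nonneg_right (hFM s) (norm_nonneg _)
    · refine intervalIntegral.norm_integral_le_abs_of_norm_le (ae_of_all _ fun s => ?_)
        (Continuous.intervalIntegrable (by fun_prop) _ _)
      rw [norm_smul]
      exact mul_le_mul_of_nonneg_right (hFM s) (norm_nonneg _)

theorem isCompact_closure_range_convolution [ProperSpace E] (hk : Continuous k) {M : ℝ}
    {F : ℕ → ℝ → ℝ} (hF : ∀ n, Continuous (F n)) (hFM : ∀ n s, |F n s| ≤ M) :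
    IsCompact (closure (range fun n => BoundedContinuousFunction.mkOfCompact
      (⟨fun t : Icc (0 : ℝ) 1 => ∫ s in (0 : ℝ)..t, F n s • k (t - s),
        (continuous_convolution (hF n) hk).comp continuous_subtype_val⟩ : C(Icc (0 : ℝ) 1, E)))) := by
  obtain ⟨ω, hωc, -, hω⟩ := exists_modulus_convolution hk M 0
  obtain ⟨B, hB⟩ := isCompact_Icc.bddAbove_image (hωc.continuousOn (s := Icc (0 : ℝ) 1))
  refine BoundedContinuousFunction.arzela_ascoli (Metric.closedBall (0 : E) B)
    (isCompact_closedBall _ _) _ ?_ ?_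
  · rintro _ t ⟨n, rfl⟩
    rw [mem_closedBall_zero_iff]
    have := hω (F n) (hF n) (hFM n) t
    simp only [intervalIntegral.integral_same, sub_zero] at this
    exact this.trans (hB (mem_image_of_mem ω t.2))
  · intro t₀
    obtain ⟨ω, hωc, hω0, hω⟩ := exists_modulus_convolution hk M (t₀ : ℝ)
    refine Metric.equicontinuousAt_of_continuity_modulus (fun t : Icc (0 : ℝ) 1 => ω t) ?_ _ ?_
    · have := (hωc.comp continuous_subtype_val).tendsto t₀
      rwa [Function.comp_apply, hω0] at this
    · refine Eventually.of_forall fun t => ?_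
      rintro ⟨_, n, rfl⟩
      rw [dist_comm, dist_eq_norm]
      exact hω (F n) (hF n) (hFM n) t

theorem tendsto_integral_smul {F : ℕ → ℝ → ℝ} {F' : ℝ → ℝ} {M t : ℝ} (ht : 0 ≤ t)
    (hF : ∀ n, Continuous (F n)) (hFM : ∀ n s, |F n s| ≤ M)
    (hlim : ∀ s ∈ Icc 0 t, Tendsto (fun n => F n s) atTop (𝓝 (F' s))) {V : Type*}
    [NormedAddCommGroup V] [NormedSpace ℝ V] {h : ℝ → V} (hh : IntervalIntegrable h volume 0 t) :
    Tendsto (fun n => ∫ s in (0 : ℝ)..t, F n s • h s) atTop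
      (𝓝 (∫ s in (0 : ℝ)..t, F' s • h s)) := by
  refine intervalIntegral.tendsto_integral_filter_of_dominated_convergence
    (fun s => M * ‖h s‖) (Eventually.of_forall fun n => ?_)
    (Eventually.of_forall fun n => ae_of_all _ fun s _ => ?_) (hh.norm.const_mul M)
    (ae_of_all _ fun s hs => ?_)
  · exact (hF _).aestronglyMeasurable.smul hh.def'.aestronglyMeasurable
  · rw [norm_smul]
    exact mul_le_mul_of_nonneg_right (hFM _ _) (norm_nonneg _)
  · rw [uIoc_of_le ht] at hs
    exact (hlim s ⟨hs.1.le, hs.2⟩).smul_const _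

/-- A Volterra equation with a bounded continuous nonlinearity, coupled to two real parameters
through integral conditions, has a solution. -/
theorem exists_solution_nonlocal [ProperSpace E] (hg : Continuous (Function.uncurry g)) {M : ℝ}
    (hM : ∀ s x, |g s x| ≤ M) (hk : Continuous k) (hL : Continuous (Function.uncurry L))
    {h : ℝ → ℂ} (hh : IntervalIntegrable h volume 0 1) :
    ∃ w : ℝ → E, Continuous w ∧ ∀ t ∈ Icc (0 : ℝ) 1,
      w t = L t (∫ s in (0 : ℝ)..1, g s (w s) • h s) +
        ∫ s in (0 : ℝ)..t, g s (w s) • k (t - s) := by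
  choose c w hwc hw hc using fun n : ℕ =>
    exists_delayed_solution_nonlocal hg hM hk hL hh (Nat.one_div_pos_of_nat (α := ℝ) (n := n))
  set F : ℕ → ℝ → ℝ := fun n s => g s (w n (max (s - 1 / ((n : ℝ) + 1)) 0)) with hFdef
  have hF : ∀ n, Continuous (F n) := fun n => by
    have h1 : Continuous fun s : ℝ => max (s - 1 / ((n : ℝ) + 1)) 0 := by fun_prop
    exact hg.comp (continuous_id.prodMk ((hwc n).comp h1))
  have hFM : ∀ n s, |F n s| ≤ M := fun n s => hM _ _
  set Z : ℕ → BoundedContinuousFunction (Icc (0 : ℝ) 1) E := fun n =>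
    BoundedContinuousFunction.mkOfCompact
      (⟨fun t : Icc (0 : ℝ) 1 => ∫ s in (0 : ℝ)..t, F n s • k (t - s),
        (continuous_convolution (hF n) hk).comp continuous_subtype_val⟩ : C(Icc (0 : ℝ) 1, E))
    with hZ
  have hcB : ∀ n, c n ∈ Metric.closedBall (0 : ℂ) (M * ∫ s in (0 : ℝ)..1, ‖h s‖) := fun n => by
    rw [mem_closedBall_zero_iff, hc n]
    exact norm_integral_smul_le (hFM n) zero_le_one hh
  obtain ⟨⟨z, c'⟩, -, φ, hφ, hlim⟩ :=
    ((isCompact_closure_range_convolution hk hF hFM).prod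
      (isCompact_closedBall (0 : ℂ) (M * ∫ s in (0 : ℝ)..1, ‖h s‖))).tendsto_subseq
      (x := fun n => (Z n, c n)) fun n => ⟨subset_closure (mem_range_self n), hcB n⟩
  have hzlim : Tendsto (fun n => Z (φ n)) atTop (𝓝 z) := hlim.fst_nhds
  have hclim : Tendsto (fun n => c (φ n)) atTop (𝓝 c') := hlim.snd_nhds
  set w' : ℝ → E := fun t => L t c' + z (projIcc 0 1 zero_le_one t) with hw'
  have hw'c : Continuous w' :=
    (hL.comp (Continuous.prodMk_left c')).add (z.continuous.comp continuous_projIcc)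
  have hFlim : ∀ s ∈ Icc (0 : ℝ) 1, Tendsto (fun n => F (φ n) s) atTop (𝓝 (g s (w' s))) := by
    intro s hs
    have hτ : Tendsto (fun n => max (s - 1 / ((φ n : ℝ) + 1)) 0) atTop (𝓝 s) := by
      have h1 := ((tendsto_one_div_add_atTop_nhds_zero_nat (𝕜 := ℝ)).comp hφ.tendsto_atTop)
      have h2 := (h1.const_sub s).max (tendsto_const_nhds (x := (0 : ℝ)))
      simpa [max_eq_left hs.1] using h2
    have hmem : ∀ n, max (s - 1 / ((φ n : ℝ) + 1)) 0 ∈ Icc (0 : ℝ) 1 := fun n =>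
      ⟨le_max_right _ _, max_le ((sub_le_self _ (by positivity)).trans hs.2) zero_le_one⟩
    have hwlim : Tendsto (fun n => w (φ n) (max (s - 1 / ((φ n : ℝ) + 1)) 0)) atTop
        (𝓝 (w' s)) := by
      have h1 : ∀ n, w (φ n) (max (s - 1 / ((φ n : ℝ) + 1)) 0) =
          L (max (s - 1 / ((φ n : ℝ) + 1)) 0) (c (φ n)) +
            Z (φ n) (projIcc 0 1 zero_le_one (max (s - 1 / ((φ n : ℝ) + 1)) 0)) := fun n => by
        rw [hw (φ n) _ (hmem n), projIcc_of_mem _ (hmem n)]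
        rfl
      simp only [h1]
      refine Tendsto.add ?_ ?_
      · exact (hL.tendsto (s, c')).comp (hτ.prodMk_nhds hclim)
      · exact (continuous_eval.tendsto
          (z, projIcc 0 1 zero_le_one s)).comp
            (hzlim.prodMk_nhds ((continuous_projIcc.tendsto s).comp hτ))
    exact (hg.tendsto (s, w' s)).comp (tendsto_const_nhds.prodMk_nhds hwlim)
  have hc' : c' = ∫ s in (0 : ℝ)..1, g s (w' s) • h s :=
    tendsto_nhds_unique (hclim.congr fun n => hc (φ n)) 
      (tendsto_integral_smul zero_le_one (fun n => hF (φ n)) (fun n => hFM (φ n)) hFlim hh)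
  refine ⟨w', hw'c, fun t ht => ?_⟩
  rw [← hc', hw']
  simp only
  congr 1
  rw [projIcc_of_mem _ ht]
  exact tendsto_nhds_unique
    (((continuous_eval_const (⟨t, ht⟩ : Icc (0 : ℝ) 1)).tendsto z).comp hzlim)
    (tendsto_integral_smul ht.1 (fun n => hF (φ n)) (fun n => hFM (φ n))
      (fun s hs => hFlim s ⟨hs.1, hs.2.trans ht.2⟩)
      (Continuous.intervalIntegrable (hk.comp (continuous_const.sub continuous_id)) _ _))

end Volterra

section GreenFunction

variable {α β ξ : ℝ}

theorem G_eq (hα : 1 < α) (hξ : ξ < 1) (t s : ℝ) :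
    G α β ξ t s = (max (t - s) 0) ^ (α - 1) / Gamma α
      + ξ / ((1 - ξ) * Gamma α) * (1 - s) ^ (α - 1)
      - Gamma (2 - β) / (Gamma (α - β) * (1 - ξ)) * (ξ + (1 - ξ) * t)
        * (1 - s) ^ (α - β - 1) := by
  have h1 : 1 - ξ ≠ 0 := by linarith
  have h2 : Gamma α ≠ 0 := (Gamma_pos_of_pos (by linarith)).ne'
  unfold G
  split_ifs with h
  · rw [max_eq_left (by linarith)]
    field_simp
  · rw [max_eq_right (by linarith), zero_rpow (by linarith)]
    field_simp
    ring

theorem intervalIntegrable_one_sub_rpow {q : ℝ} (hq : -1 < q) :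
    IntervalIntegrable (fun s : ℝ => (1 - s) ^ q) volume 0 1 := by
  have := (intervalIntegral.intervalIntegrable_rpow' (a := 1) (b := 0) hq).comp_sub_left 1
  simpa using this

theorem intervalIntegrable_ofReal_one_sub_rpow {q : ℝ} (hq : -1 < q) :
    IntervalIntegrable (fun s : ℝ => (((1 - s) ^ q : ℝ) : ℂ)) volume 0 1 :=
  ⟨(intervalIntegrable_one_sub_rpow hq).1.ofReal, (intervalIntegrable_one_sub_rpow hq).2.ofReal⟩

theorem integral_one_sub_rpow {q : ℝ} (hq : -1 < q) :
    ∫ s in (0 : ℝ)..1, (1 - s) ^ q = 1 / (q + 1) := by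
  rw [intervalIntegral.integral_comp_sub_left (fun s : ℝ => s ^ q) 1,
    integral_rpow (Or.inl hq)]
  simp [zero_rpow (by linarith : q + 1 ≠ 0)]

theorem continuous_max_rpow (hα : 1 < α) (t : ℝ) :
    Continuous fun s : ℝ => (max (t - s) 0) ^ (α - 1) :=
  Continuous.rpow_const (by fun_prop) fun _ => Or.inr (by linarith)

theorem intervalIntegrable_G (hα : 1 < α) (hβ : β < 1) (hξ : ξ < 1) (t : ℝ) :
    IntervalIntegrable (G α β ξ t) volume 0 1 := by
  rw [funext (G_eq (β := β) hα hξ t)]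
  refine IntervalIntegrable.sub (IntervalIntegrable.add ?_ ?_) ?_
  · exact ((continuous_max_rpow hα t).div_const _).intervalIntegrable _ _
  · exact (intervalIntegrable_one_sub_rpow (by linarith)).const_mul _
  · exact (intervalIntegrable_one_sub_rpow (by linarith)).const_mul _

theorem bddAbove_range_integral_abs_G (hα : 1 < α) (hβ : β < 1) (hξ0 : 0 < ξ)
    (hξ : ξ < 1) :
    BddAbove (range fun t : Icc (0 : ℝ) 1 => ∫ s in (0 : ℝ)..1, |G α β ξ (t : ℝ) s|) := by
  have hΓα : 0 < Gamma α := Gamma_pos_of_pos (by linarith)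
  have hΓαβ : 0 < Gamma (α - β) := Gamma_pos_of_pos (by linarith)
  have hΓβ : 0 < Gamma (2 - β) := Gamma_pos_of_pos (by linarith)
  have h1ξ : 0 < 1 - ξ := by linarith
  refine ⟨∫ s in (0 : ℝ)..1, (1 / Gamma α + ξ / ((1 - ξ) * Gamma α) * (1 - s) ^ (α - 1)
      + Gamma (2 - β) / (Gamma (α - β) * (1 - ξ)) * (1 - s) ^ (α - β - 1)), ?_⟩
  rintro _ ⟨⟨t, ht⟩, rfl⟩
  refine intervalIntegral.integral_mono_on zero_le_one
    (intervalIntegrable_G hα hβ hξ t).abs ?_ fun s hs => ?_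
  · exact (intervalIntegrable_const.add
      ((intervalIntegrable_one_sub_rpow (by linarith)).const_mul _)).add
      ((intervalIntegrable_one_sub_rpow (by linarith)).const_mul _)
  · rw [G_eq hα hξ]
    have hs1 : 0 ≤ 1 - s := by linarith [hs.2]
    have ha : 0 ≤ ξ / ((1 - ξ) * Gamma α) * (1 - s) ^ (α - 1) := by positivity
    have hb : 0 ≤ (max (t - s) 0) ^ (α - 1) / Gamma α := by positivity
    have hb' : (max (t - s) 0) ^ (α - 1) / Gamma α ≤ 1 / Gamma α := by
      gcongr
      exact rpow_le_one (le_max_right _ _)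
        (max_le (by linarith [hs.1, ht.2]) zero_le_one) (by linarith)
    have hc : 0 ≤ Gamma (2 - β) / (Gamma (α - β) * (1 - ξ)) * (1 - s) ^ (α - β - 1) := by
      positivity
    have hd : 0 ≤ ξ + (1 - ξ) * t := by have := ht.1; positivity
    have hd' : ξ + (1 - ξ) * t ≤ 1 := by nlinarith [ht.2]
    have he := mul_le_of_le_one_right hc hd'
    have he' := mul_nonneg hc hd
    rw [mul_right_comm, abs_le]
    constructor <;> linarith

theorem integral_abs_G_le_Gstar (hα : 1 < α) (hβ : β < 1) (hξ0 : 0 < ξ)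
    (hξ : ξ < 1) {t : ℝ} (ht : t ∈ Icc (0 : ℝ) 1) :
    ∫ s in (0 : ℝ)..1, |G α β ξ t s| ≤ Gstar α β ξ :=
  le_ciSup (bddAbove_range_integral_abs_G hα hβ hξ0 hξ) (⟨t, ht⟩ : Icc (0 : ℝ) 1)

theorem integral_smul_max_rpow (hα : 1 < α) {F : ℝ → ℝ} (hF : Continuous F) {t : ℝ}
    (ht : t ∈ Icc (0 : ℝ) 1) :
    ∫ s in (0 : ℝ)..1, (max (t - s) 0) ^ (α - 1) * F s =
      ∫ s in (0 : ℝ)..t, (max (t - s) 0) ^ (α - 1) * F s := by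
  have hi : ∀ a b : ℝ,
      IntervalIntegrable (fun s => (max (t - s) 0) ^ (α - 1) * F s) volume a b := fun a b =>
    ((continuous_max_rpow hα t).mul hF).intervalIntegrable _ _
  rw [← intervalIntegral.integral_add_adjacent_intervals (hi 0 t) (hi t 1), add_eq_left]
  refine (intervalIntegral.integral_congr (g := fun _ => 0) fun s hs => ?_).trans (by simp)
  rw [uIcc_of_le ht.2] at hs
  simp [max_eq_right (sub_nonpos.2 hs.1), zero_rpow (by linarith : α - 1 ≠ 0)]

theorem integral_G_mul (hα : 1 < α) (hβ : β < 1) (hξ : ξ < 1) {F : ℝ → ℝ}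
    (hF : Continuous F) {t : ℝ} (ht : t ∈ Icc (0 : ℝ) 1) :
    ∫ s in (0 : ℝ)..1, G α β ξ t s * F s =
      (∫ s in (0 : ℝ)..t, (max (t - s) 0) ^ (α - 1) * F s) / Gamma α
      + ξ / ((1 - ξ) * Gamma α) * (∫ s in (0 : ℝ)..1, (1 - s) ^ (α - 1) * F s)
      - Gamma (2 - β) / (Gamma (α - β) * (1 - ξ)) * (ξ + (1 - ξ) * t)
        * ∫ s in (0 : ℝ)..1, (1 - s) ^ (α - β - 1) * F s := by
  have h1 : IntervalIntegrable (fun s => (max (t - s) 0) ^ (α - 1) * F s / Gamma α)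
      volume 0 1 :=
    (((continuous_max_rpow hα t).mul hF).div_const _).intervalIntegrable _ _
  have h2 : ∀ {q : ℝ}, -1 < q → ∀ C : ℝ,
      IntervalIntegrable (fun s => C * ((1 - s) ^ q * F s)) volume 0 1 := fun hq C =>
    ((intervalIntegrable_one_sub_rpow hq).mul_continuousOn hF.continuousOn).const_mul C
  rw [← integral_smul_max_rpow hα hF ht, ← intervalIntegral.integral_div,
    ← intervalIntegral.integral_const_mul, ← intervalIntegral.integral_const_mul,
    ← intervalIntegral.integral_add h1 (h2 (by linarith) _),
    ← intervalIntegral.integral_sub (h1.add (h2 (by linarith) _)) (h2 (by linarith) _)]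
  congr 1 with s
  rw [G_eq hα hξ]
  ring

end GreenFunction

/-- The fixed point system of the boundary value problem is solvable for every bounded continuous
right-hand side. -/
theorem exists_solution_of_bounded {α β ξ : ℝ} (hα : 1 < α) (hα2 : α ≤ 2) (hβ : β < 1)
    (hξ : ξ < 1) {g : ℝ → ℝ × ℝ → ℝ} (hg : Continuous (Function.uncurry g)) {M : ℝ}
    (hM : ∀ s x, |g s x| ≤ M) :
    ∃ w : ℝ → ℝ × ℝ, Continuous w ∧ ∀ t ∈ Icc (0 : ℝ) 1,
      (w t).1 = (∫ s in (0 : ℝ)..1, G α β ξ t s * g s (w s)) ∧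
      (w t).2 = (∫ s in (0 : ℝ)..t, g s (w s))
        - (Gamma (2 - β) * t ^ (2 - α) / (Gamma (3 - α) * Gamma (α - β)))
          * ∫ s in (0 : ℝ)..1, (1 - s) ^ (α - β - 1) * g s (w s) := by
  have hh : IntervalIntegrable (fun s : ℝ => (((1 - s) ^ (α - 1) : ℝ) : ℂ)
      + (((1 - s) ^ (α - β - 1) : ℝ) : ℂ) * Complex.I) volume 0 1 :=
    (intervalIntegrable_ofReal_one_sub_rpow (by linarith)).add
      ((intervalIntegrable_ofReal_one_sub_rpow (by linarith)).mul_const _)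
  have hk : Continuous fun x : ℝ => ((max x 0) ^ (α - 1) / Gamma α, (1 : ℝ)) :=
    ((Continuous.rpow_const (by fun_prop) fun _ => Or.inr (by linarith)).div_const _).prodMk
      continuous_const
  have hL : Continuous (Function.uncurry fun (t : ℝ) (c : ℂ) =>
      (ξ / ((1 - ξ) * Gamma α) * c.re
        - Gamma (2 - β) / (Gamma (α - β) * (1 - ξ)) * (ξ + (1 - ξ) * t) * c.im,
      - (Gamma (2 - β) * t ^ (2 - α) / (Gamma (3 - α) * Gamma (α - β)) * c.im))) := by
    have h1 : Continuous fun q : ℝ × ℂ => q.1 ^ (2 - α) :=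
      continuous_fst.rpow_const fun _ => Or.inr (by linarith)
    refine Continuous.prodMk (by fun_prop) ?_
    exact (((h1.const_mul _).div_const _).mul (Complex.continuous_im.comp continuous_snd)).neg
  obtain ⟨w, hwc, hw⟩ := exists_solution_nonlocal hg hM hk hL hh
  have hF : Continuous fun s => g s (w s) := hg.comp (continuous_id.prodMk hwc)
  have hre := Complex.reCLM.intervalIntegral_comp_comm (hh.continuousOn_smul hF.continuousOn)
  have him := Complex.imCLM.intervalIntegral_comp_comm (hh.continuousOn_smul hF.continuousOn)
  refine ⟨w, hwc, fun t ht => ?_⟩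
  have hkt : IntervalIntegrable
      (fun s => g s (w s) • ((max (t - s) 0) ^ (α - 1) / Gamma α, (1 : ℝ))) volume 0 t :=
    (hF.smul (hk.comp (continuous_const.sub continuous_id))).intervalIntegrable _ _
  have hfst := (ContinuousLinearMap.fst ℝ ℝ ℝ).intervalIntegral_comp_comm hkt
  have hsnd := (ContinuousLinearMap.snd ℝ ℝ ℝ).intervalIntegral_comp_comm hkt
  simp only [Complex.reCLM_apply, Complex.imCLM_apply, Complex.real_smul, Complex.re_ofReal_mul,
    Complex.im_ofReal_mul, Complex.add_re, Complex.add_im, Complex.ofReal_re, Complex.ofReal_im,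
    Complex.mul_I_re, Complex.mul_I_im, neg_zero, add_zero, zero_add] at hre him
  simp only [ContinuousLinearMap.coe_fst', ContinuousLinearMap.coe_snd', Prod.smul_mk,
    smul_eq_mul, mul_one] at hfst hsnd
  rw [hw t ht]
  simp only [Prod.fst_add, Prod.snd_add, Complex.real_smul, Prod.smul_mk, smul_eq_mul, mul_one]
  rw [← hfst, ← hsnd, ← hre, ← him, integral_G_mul hα hβ hξ hF ht,
    ← intervalIntegral.integral_div]
  constructor
  · simp only [mul_comm (g _ _), div_mul_eq_mul_div]
    ring
  · simp only [mul_comm (g _ _)]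
    ring

/-- Existence (Theorem 2.2): under (A₁) and (A₂) the fixed point system corresponding to the
BVP `ᶜDᵅu = f(t,u,ᶜD^{α−1}u)`, `u(0)=ξu(1)`, `ᶜDᵝu(0)=ξᶜDᵝu(1)` has a solution `(u,v)`
with `|u| ≤ r` and `|v| ≤ r` on `[0,1]`. -/
theorem existence_of_solution (α β ξ : ℝ) (hα : 1 < α ∧ α ≤ 2) (hβ : 0 < β ∧ β < 1)
    (hξ : 0 < ξ ∧ ξ < 1) (f : ℝ → ℝ → ℝ → ℝ)
    (hf : ContinuousOn (fun q : ℝ × ℝ × ℝ => f q.1 q.2.1 q.2.2)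
        (Set.Icc (0 : ℝ) 1 ×ˢ (Set.univ : Set (ℝ × ℝ))))
    (p : ℝ → ℝ) (hp : ContinuousOn p (Set.Icc 0 1)) (hp0 : ∀ t ∈ Set.Icc (0 : ℝ) 1, 0 ≤ p t)
    (ψ : ℝ → ℝ) (hψc : ContinuousOn ψ (Set.Ici 0)) (hψ0 : ∀ x ∈ Set.Ici (0 : ℝ), 0 < ψ x)
    (hψm : MonotoneOn ψ (Set.Ici 0))
    (hA₁ : ∀ t ∈ Set.Icc (0 : ℝ) 1, ∀ u z : ℝ, |f t u z| ≤ p t * ψ |z|)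
    (r : ℝ) (hr : 0 < r)
    (hA₂ : r ≥ max (Gstar α β ξ * sSup (p '' Set.Icc 0 1) * ψ r)
        (sSup (p '' Set.Icc 0 1) * ψ r
          * ((Real.Gamma (3 - α) * Real.Gamma (α - β + 1) + Real.Gamma (2 - β))
              / (Real.Gamma (3 - α) * Real.Gamma (α - β + 1))))) :
    ∃ u v : ℝ → ℝ, ContinuousOn u (Set.Icc 0 1) ∧ ContinuousOn v (Set.Icc 0 1)
      ∧ (∀ t ∈ Set.Icc (0 : ℝ) 1, |u t| ≤ r) ∧ (∀ t ∈ Set.Icc (0 : ℝ) 1, |v t| ≤ r)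
      ∧ (∀ t ∈ Set.Icc (0 : ℝ) 1,
          u t = ∫ s in (0 : ℝ)..1, G α β ξ t s * f s (u s) (v s))
      ∧ (∀ t ∈ Set.Icc (0 : ℝ) 1,
          v t = (∫ s in (0 : ℝ)..t, f s (u s) (v s))
            - (Real.Gamma (2 - β) * t ^ (2 - α) / (Real.Gamma (3 - α) * Real.Gamma (α - β)))
                * (∫ s in (0 : ℝ)..1, (1 - s) ^ (α - β - 1) * f s (u s) (v s))) := by
  obtain ⟨hα1, hα2⟩ := hα
  obtain ⟨hβ0, hβ1⟩ := hβ
  obtain ⟨hξ0, hξ1⟩ := hξ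
  set P := sSup (p '' Icc 0 1) with hP
  have hpP : ∀ t ∈ Icc (0 : ℝ) 1, p t ≤ P := fun t ht =>
    le_csSup (isCompact_Icc.bddAbove_image hp) (mem_image_of_mem p ht)
  have hψr : 0 < ψ r := hψ0 r hr.le
  have hP0 : 0 ≤ P := (hp0 0 (by simp)).trans (hpP 0 (by simp))
  have hclamp : ∀ x : ℝ, |max (-r) (min x r)| ≤ r := fun x =>
    abs_le.2 ⟨le_max_left _ _, max_le (by linarith) (min_le_right _ _)⟩
  have hclamp_eq : ∀ x : ℝ, |x| ≤ r → max (-r) (min x r) = x := fun x hx => by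
    rw [min_eq_left (abs_le.1 hx).2, max_eq_right (abs_le.1 hx).1]
  set g : ℝ → ℝ × ℝ → ℝ := fun s x =>
    f (projIcc 0 1 zero_le_one s) (max (-r) (min x.1 r)) (max (-r) (min x.2 r)) with hgdef
  have hg : Continuous (Function.uncurry g) := by
    refine hf.comp_continuous (f := fun q : ℝ × ℝ × ℝ =>
      ((projIcc (0 : ℝ) 1 zero_le_one q.1 : ℝ), max (-r) (min q.2.1 r), max (-r) (min q.2.2 r)))
      ?_ fun q => ⟨(projIcc (0 : ℝ) 1 zero_le_one q.1).2, mem_univ _⟩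
    exact (continuous_subtype_val.comp (continuous_projIcc.comp continuous_fst)).prodMk
      (by fun_prop)
  have hM : ∀ s x, |g s x| ≤ P * ψ r := fun s x =>
    (hA₁ _ (projIcc (0 : ℝ) 1 zero_le_one s).2 _ _).trans <|
      mul_le_mul (hpP _ (Subtype.prop _)) (hψm (mem_Ici.2 (abs_nonneg _)) hr.le (hclamp _))
        (hψ0 _ (mem_Ici.2 (abs_nonneg _))).le hP0
  obtain ⟨w, hwc, hw⟩ := exists_solution_of_bounded (β := β) (ξ := ξ) hα1 hα2 hβ1 hξ1 hg hM
  have hPψ : 0 ≤ P * ψ r := by positivity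
  have hu : ∀ t ∈ Icc (0 : ℝ) 1, |(w t).1| ≤ r := fun t ht => by
    rw [(hw t ht).1]
    have h1 := norm_integral_smul_le (fun s => hM s (w s)) zero_le_one
      (intervalIntegrable_G (β := β) hα1 hβ1 hξ1 t)
    simp only [smul_eq_mul, norm_eq_abs, mul_comm (g _ _)] at h1
    refine h1.trans ((mul_le_mul_of_nonneg_left
      (integral_abs_G_le_Gstar hα1 hβ1 hξ0 hξ1 ht) hPψ).trans ?_)
    refine le_trans (le_of_eq ?_) ((le_max_left _ _).trans hA₂)
    ring
  have hΓ1 : 0 < Gamma (3 - α) := Gamma_pos_of_pos (by linarith)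
  have hΓ2 : 0 < Gamma (α - β) := Gamma_pos_of_pos (by linarith)
  have hΓ3 : 0 < Gamma (2 - β) := Gamma_pos_of_pos (by linarith)
  have hv : ∀ t ∈ Icc (0 : ℝ) 1, |(w t).2| ≤ r := fun t ht => by
    rw [(hw t ht).2]
    have h1 : |∫ s in (0 : ℝ)..t, g s (w s)| ≤ P * ψ r := by
      have := intervalIntegral.norm_integral_le_of_norm_le_const (a := 0) (b := t)
        (f := fun s => g s (w s)) fun s _ => hM s (w s)
      rw [sub_zero, abs_of_nonneg ht.1] at this
      exact this.trans (mul_le_of_le_one_right hPψ ht.2)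
    have h2 : |∫ s in (0 : ℝ)..1, (1 - s) ^ (α - β - 1) * g s (w s)|
        ≤ P * ψ r * (1 / (α - β)) := by
      have := norm_integral_smul_le (fun s => hM s (w s)) zero_le_one
        (intervalIntegrable_one_sub_rpow (q := α - β - 1) (by linarith))
      simp only [smul_eq_mul, norm_eq_abs, mul_comm (g _ _)] at this
      refine this.trans (le_of_eq ?_)
      congr 1
      rw [show 1 / (α - β) = 1 / (α - β - 1 + 1) by ring,
        ← integral_one_sub_rpow (q := α - β - 1) (by linarith)]
      refine intervalIntegral.integral_congr fun s hs => ?_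
      rw [uIcc_of_le zero_le_one] at hs
      exact abs_of_nonneg (rpow_nonneg (by linarith [hs.2]) _)
    have hC0 : 0 ≤ Gamma (2 - β) * t ^ (2 - α) / (Gamma (3 - α) * Gamma (α - β)) := by
      have := ht.1
      positivity
    have hC : Gamma (2 - β) * t ^ (2 - α) / (Gamma (3 - α) * Gamma (α - β)) ≤
        Gamma (2 - β) / (Gamma (3 - α) * Gamma (α - β)) := by
      gcongr
      exact mul_le_of_le_one_right hΓ3.le (rpow_le_one ht.1 ht.2 (by linarith))
    refine (abs_sub _ _).trans ?_
    rw [abs_mul, abs_of_nonneg hC0]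
    refine (add_le_add h1 (mul_le_mul hC h2 (abs_nonneg _) (hC0.trans hC))).trans ?_
    refine le_trans (le_of_eq ?_) ((le_max_right _ _).trans hA₂)
    have hαβ : α - β ≠ 0 := by linarith
    rw [Gamma_add_one hαβ]
    field_simp
  have hgf : ∀ s ∈ Icc (0 : ℝ) 1, g s (w s) = f s (w s).1 (w s).2 := fun s hs => by
    simp only [hgdef, projIcc_of_mem _ hs, hclamp_eq _ (hu s hs), hclamp_eq _ (hv s hs)]
  have hsub : ∀ t ∈ Icc (0 : ℝ) 1, ∀ s ∈ uIcc 0 t, s ∈ Icc (0 : ℝ) 1 := fun t ht s hs => by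
    rw [uIcc_of_le ht.1] at hs
    exact ⟨hs.1, hs.2.trans ht.2⟩
  have h01 : (1 : ℝ) ∈ Icc (0 : ℝ) 1 := ⟨zero_le_one, le_rfl⟩
  refine ⟨fun t => (w t).1, fun t => (w t).2, hwc.fst.continuousOn, hwc.snd.continuousOn, hu, hv,
    fun t ht => ?_, fun t ht => ?_⟩
  · refine (hw t ht).1.trans (intervalIntegral.integral_congr fun s hs => ?_)
    simp only [hgf s (hsub 1 h01 s hs)]
  · refine (hw t ht).2.trans (congrArg₂ _ ?_ (congrArg _ ?_)) <;>
      refine intervalIntegral.integral_congr fun s hs => ?_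
    · exact hgf s (hsub t ht s hs)
    · simp only [hgf s (hsub 1 h01 s hs)]
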